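/- arXiv:2204.13231 — 3 statements merged into one kernel-verified Lean document; each statement's English description precedes it below -/
import Mathlib

section
/- Let $F_0$ be a probability measure on $\mathbb{R}^d$ such that $\int e^{\beta \cdot x}(1+\|x\|^2)\,dF_0(x) < \infty$ for every $\beta \in \mathbb{R}^d$, and suppose $F_0$ surrounds the point $\bar{x} \in \mathbb{R}^d$. Then there exists exactly one $\beta_* \in \mathbb{R}^d$ such that $\int e^{\beta_* \cdot x}(x - \bar{x})\,dF_0(x) = 0$, i.e. such that the exponentially tilted mean $\int e^{\beta_* \cdot x} x\,dF_0(x) \,/\, \int e^{\beta_* \cdot x}\,dF_0(x)$ equals $\bar{x}$. -/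
open MeasureTheory RealInnerProductSpace

/-- A probability measure `F0` on `ℝ^d` surrounds the point `xbar` if there are `ε > 0` and
`δ > 0` such that for every unit vector `ω`, `F0 {x | (x - xbar)·ω > ε} > δ`. -/
def SurroundsE {d : ℕ} (F0 : Measure (EuclideanSpace ℝ (Fin d)))
    (xbar : EuclideanSpace ℝ (Fin d)) : Prop :=
  ∃ ε δ : ℝ, 0 < ε ∧ 0 < δ ∧
    ∀ ω : EuclideanSpace ℝ (Fin d), ‖ω‖ = 1 →
      ENNReal.ofReal δ < F0 {x | ε < ⟪x - xbar, ω⟫}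

section Tilting

variable {E : Type*} [NormedAddCommGroup E] [InnerProductSpace ℝ E] [MeasurableSpace E]
  {μ : Measure E} {c : E}

lemma integrable_exp_inner_sub [BorelSpace E] [SecondCountableTopology E]
    (h : ∀ β : E, Integrable (fun x => Real.exp ⟪β, x⟫ * (1 + ‖x‖ ^ 2)) μ) (β : E) :
    Integrable (fun x => Real.exp ⟪β, x - c⟫) μ := by
  have h1 : Integrable (fun x => Real.exp ⟪β, x⟫) μ := by
    refine (h β).mono' (by fun_prop) (.of_forall fun x => ?_)
    rw [Real.norm_of_nonneg (Real.exp_pos _).le]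
    exact le_mul_of_one_le_right (Real.exp_pos _).le (by nlinarith [sq_nonneg ‖x‖])
  simpa only [inner_sub_right, Real.exp_sub] using h1.div_const _

lemma integrable_exp_inner_sub_smul_sub [BorelSpace E] [SecondCountableTopology E]
    (h : ∀ β : E, Integrable (fun x => Real.exp ⟪β, x⟫ * (1 + ‖x‖ ^ 2)) μ) (β : E) :
    Integrable (fun x => Real.exp ⟪β, x - c⟫ • (x - c)) μ := by
  refine ((h β).mul_const ((1 + ‖c‖) * Real.exp (-⟪β, c⟫))).mono' (by fun_prop)
    (.of_forall fun x => ?_)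
  rw [norm_smul, Real.norm_of_nonneg (Real.exp_pos _).le, inner_sub_right, sub_eq_add_neg,
    Real.exp_add, mul_assoc, mul_assoc, mul_comm (Real.exp (-⟪β, c⟫)), ← mul_assoc (1 + ‖x‖ ^ 2)]
  gcongr
  have := norm_sub_le x c
  nlinarith [sq_nonneg (‖x‖ - 1), mul_nonneg (norm_nonneg c) (sq_nonneg ‖x‖), norm_nonneg c]

lemma integral_exp_inner_smul_sub_eq_zero_iff [CompleteSpace E] {β : E}
    (h : Integrable (fun x => Real.exp ⟪β, x - c⟫ • (x - c)) μ) :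
    ∫ x, Real.exp ⟪β, x⟫ • (x - c) ∂μ = 0 ↔
      ∀ v : E, ∫ x, Real.exp ⟪β, x - c⟫ * ⟪v, x - c⟫ ∂μ = 0 := by
  have hcenter (x : E) : Real.exp ⟪β, x⟫ • (x - c) =
      Real.exp ⟪β, c⟫ • Real.exp ⟪β, x - c⟫ • (x - c) := by
    rw [smul_smul, ← Real.exp_add, inner_sub_right, add_sub_cancel]
  have hinner (v : E) : ∫ x, Real.exp ⟪β, x - c⟫ * ⟪v, x - c⟫ ∂μ =
      ⟪v, ∫ x, Real.exp ⟪β, x - c⟫ • (x - c) ∂μ⟫ := by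
    rw [← integral_inner h]
    simp only [real_inner_smul_right]
  simp only [hcenter, hinner, integral_smul, smul_eq_zero, (Real.exp_pos _).ne', false_or]
  exact ⟨fun h0 v => by rw [h0, inner_zero_right],
    fun h0 => ext_inner_left ℝ fun v => by rw [h0, inner_zero_right]⟩

lemma convexOn_integral_exp_inner_sub (h : ∀ β : E, Integrable (fun x => Real.exp ⟪β, x - c⟫) μ) :
    ConvexOn ℝ Set.univ (fun β : E => ∫ x, Real.exp ⟪β, x - c⟫ ∂μ) := by
  refine ⟨convex_univ, fun a _ b _ s t hs ht hst => ?_⟩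
  simp only [smul_eq_mul]
  rw [← integral_const_mul, ← integral_const_mul,
    ← integral_add ((h a).const_mul s) ((h b).const_mul t)]
  refine integral_mono (h _) (((h a).const_mul s).add ((h b).const_mul t)) fun x => ?_
  simpa [inner_add_left, real_inner_smul_left] using
    convexOn_exp.2 (Set.mem_univ ⟪a, x - c⟫) (Set.mem_univ ⟪b, x - c⟫) hs ht hst

/-- The tilted first moment vanishes at a minimiser of `β ↦ ∫ exp ⟪β, x - c⟫ ∂μ`. -/
lemma integral_exp_mul_inner_eq_zero_of_forall_le [NeZero μ]
    (h : ∀ β : E, Integrable (fun x => Real.exp ⟪β, x - c⟫) μ) {β : E}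
    (hβ : ∀ γ : E, ∫ x, Real.exp ⟪β, x - c⟫ ∂μ ≤ ∫ x, Real.exp ⟪γ, x - c⟫ ∂μ) (v : E) :
    ∫ x, Real.exp ⟪β, x - c⟫ * ⟪v, x - c⟫ ∂μ = 0 := by
  set ν := μ.tilted fun x => ⟪β, x - c⟫
  set Z := ∫ x, Real.exp ⟪β, x - c⟫ ∂μ
  have hZ : 0 < Z := integral_exp_pos (h β)
  have key (t : ℝ) (x : E) : Real.exp ⟪β, x - c⟫ * Real.exp (t * ⟪v, x - c⟫)
      = Real.exp ⟪β + t • v, x - c⟫ := by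
    rw [← Real.exp_add, inner_add_left, real_inner_smul_left]
  have hint (t : ℝ) : Integrable (fun x => Real.exp (t * ⟪v, x - c⟫)) ν := by
    rw [integrable_tilted_iff (h β)]
    simpa only [smul_eq_mul, key] using h (β + t • v)
  have hset : ProbabilityTheory.integrableExpSet (fun x => ⟪v, x - c⟫) ν = Set.univ :=
    Set.eq_univ_of_forall hint
  have hd := ProbabilityTheory.hasDerivAt_mgf (X := fun x => ⟪v, x - c⟫) (μ := ν) (t := 0)
    (by simp [hset])
  have hmgf (t : ℝ) : ProbabilityTheory.mgf (fun x => ⟪v, x - c⟫) ν t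
      = (∫ x, Real.exp ⟪β + t • v, x - c⟫ ∂μ) / Z := by
    rw [ProbabilityTheory.mgf, integral_tilted, ← integral_div]
    simp only [smul_eq_mul, div_mul_eq_mul_div, key]
    rfl
  have hmin : IsLocalMin (ProbabilityTheory.mgf (fun x => ⟪v, x - c⟫) ν) 0 :=
    .of_forall fun t => by
      rw [hmgf, hmgf]
      refine div_le_div_of_nonneg_right ?_ hZ.le
      simpa using hβ (β + t • v)
  have h0 := hmin.hasDerivAt_eq_zero hd
  rw [integral_tilted] at h0
  simp only [zero_mul, Real.exp_zero, mul_one, smul_eq_mul, div_mul_eq_mul_div] at h0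
  rw [integral_div] at h0
  exact (div_eq_zero_iff.1 h0).resolve_right hZ.ne'

/-- Strict monotonicity of `β ↦ ∫ exp ⟪β, x - c⟫ • (x - c) ∂μ` along directions in which `μ` is
not degenerate. -/
lemma ae_inner_eq_zero_of_integral_eq {β γ : E}
    (hγ : Integrable (fun x => Real.exp ⟪γ, x - c⟫ • (x - c)) μ)
    (hβ : Integrable (fun x => Real.exp ⟪β, x - c⟫ • (x - c)) μ)
    (h : ∫ x, Real.exp ⟪γ, x - c⟫ * ⟪γ - β, x - c⟫ ∂μ =
      ∫ x, Real.exp ⟪β, x - c⟫ * ⟪γ - β, x - c⟫ ∂μ) :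
    ∀ᵐ x ∂μ, ⟪γ - β, x - c⟫ = 0 := by
  have hγ' := hγ.const_inner (𝕜 := ℝ) (γ - β)
  have hβ' := hβ.const_inner (𝕜 := ℝ) (γ - β)
  simp only [real_inner_smul_right] at hγ' hβ'
  have h_nonneg (x : E) : 0 ≤ Real.exp ⟪γ, x - c⟫ * ⟪γ - β, x - c⟫ -
      Real.exp ⟪β, x - c⟫ * ⟪γ - β, x - c⟫ := by
    rw [← sub_mul, inner_sub_left]
    rcases le_total ⟪β, x - c⟫ ⟪γ, x - c⟫ with hle | hle
    · exact mul_nonneg (sub_nonneg.2 (Real.exp_le_exp.2 hle)) (sub_nonneg.2 hle)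
    · exact mul_nonneg_of_nonpos_of_nonpos (sub_nonpos.2 (Real.exp_le_exp.2 hle))
        (sub_nonpos.2 hle)
  have hae := (integral_eq_zero_iff_of_nonneg h_nonneg (hγ'.sub hβ')).1
    ((integral_sub hγ' hβ').trans (sub_eq_zero.2 h))
  filter_upwards [hae] with x hx
  rw [Pi.zero_apply, ← sub_mul, mul_eq_zero, sub_eq_zero, Real.exp_eq_exp] at hx
  rcases hx with hx | hx
  · rw [inner_sub_left, hx, sub_self]
  · exact hx

end Tilting

lemma SurroundsE.tendsto_integral_exp {d : ℕ} {F0 : Measure (EuclideanSpace ℝ (Fin d))}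
    [IsFiniteMeasure F0] {c : EuclideanSpace ℝ (Fin d)} (hsur : SurroundsE F0 c)
    (h : ∀ β : EuclideanSpace ℝ (Fin d), Integrable (fun x => Real.exp ⟪β, x - c⟫) F0) :
    Filter.Tendsto (fun β : EuclideanSpace ℝ (Fin d) => ∫ x, Real.exp ⟪β, x - c⟫ ∂F0)
      (Filter.cocompact _) Filter.atTop := by
  obtain ⟨ε, δ, hε, hδ, hs⟩ := hsur
  refine Filter.tendsto_atTop_mono' _ (f₁ := fun β => Real.exp (ε * ‖β‖) * δ) ?_ ?_
  · filter_upwards [tendsto_norm_cocompact_atTop.eventually_gt_atTop 0]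
      with β hβ
    have hω := hs (‖β‖⁻¹ • β) (by simp [norm_smul, hβ.ne'])
    have hδ' : δ ≤ F0.real {x | ε < ⟪x - c, ‖β‖⁻¹ • β⟫} :=
      (ENNReal.ofReal_le_iff_le_toReal (measure_ne_top _ _)).1 hω.le
    have hsub : {x | ε < ⟪x - c, ‖β‖⁻¹ • β⟫} ⊆
        {x | Real.exp (ε * ‖β‖) ≤ Real.exp ⟪β, x - c⟫} := by
      intro x hx
      rw [Set.mem_ofPred_eq, real_inner_smul_right, ← div_eq_inv_mul, lt_div_iff₀ hβ,
        real_inner_comm] at hx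
      exact Real.exp_le_exp.2 hx.le
    calc Real.exp (ε * ‖β‖) * δ
        ≤ Real.exp (ε * ‖β‖) * F0.real {x | Real.exp (ε * ‖β‖) ≤ Real.exp ⟪β, x - c⟫} := by
          gcongr
          exact hδ'.trans (measureReal_mono hsub)
      _ ≤ _ := mul_meas_ge_le_integral_of_nonneg (.of_forall fun _ => (Real.exp_pos _).le) (h β) _
  · exact (Real.tendsto_exp_atTop.comp
      (tendsto_norm_cocompact_atTop.const_mul_atTop hε)).atTop_mul_const hδ

lemma SurroundsE.eq_zero_of_ae_inner_eq_zero {d : ℕ} {F0 : Measure (EuclideanSpace ℝ (Fin d))}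
    {c v : EuclideanSpace ℝ (Fin d)} (hsur : SurroundsE F0 c)
    (h : ∀ᵐ x ∂F0, ⟪v, x - c⟫ = 0) : v = 0 := by
  obtain ⟨ε, δ, hε, -, hs⟩ := hsur
  by_contra hv
  refine (zero_le.trans_lt (hs (‖v‖⁻¹ • v) (by simp [norm_smul, hv]))).ne' ?_
  refine measure_mono_null (fun x hx => ?_) (ae_iff.1 h)
  intro h0
  rw [Set.mem_ofPred_eq, real_inner_smul_right, real_inner_comm, h0, mul_zero] at hx
  exact hx.not_gt hε

/-- Existence and uniqueness of the limiting slope: there is exactly one `βs` such that the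
exponentially tilted mean of `F0` equals `xbar`. -/
theorem existsUnique_tilting_parameter {d : ℕ}
    (F0 : Measure (EuclideanSpace ℝ (Fin d))) [IsProbabilityMeasure F0]
    (hmom : ∀ β : EuclideanSpace ℝ (Fin d),
      Integrable (fun x => Real.exp ⟪β, x⟫ * (1 + ‖x‖ ^ 2)) F0)
    (xbar : EuclideanSpace ℝ (Fin d)) (hsur : SurroundsE F0 xbar) :
    ∃! βs : EuclideanSpace ℝ (Fin d),
      ∫ x, Real.exp ⟪βs, x⟫ • (x - xbar) ∂F0 = 0 := by
  have hexp := integrable_exp_inner_sub (c := xbar) hmom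
  have hsmul := integrable_exp_inner_sub_smul_sub (c := xbar) hmom
  simp only [fun β => integral_exp_inner_smul_sub_eq_zero_iff (hsmul β)]
  obtain ⟨β, hβ⟩ := (continuousOn_univ.1
    ((convexOn_integral_exp_inner_sub hexp).continuousOn isOpen_univ)).exists_forall_le
      (hsur.tendsto_integral_exp hexp)
  have hβ0 := integral_exp_mul_inner_eq_zero_of_forall_le hexp hβ
  refine ⟨β, hβ0, fun γ hγ => sub_eq_zero.1 (hsur.eq_zero_of_ae_inner_eq_zero ?_)⟩
  exact ae_inner_eq_zero_of_integral_eq (hsmul γ) (hsmul β) ((hγ _).trans (hβ0 _).symm)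
end

section
/- Let $\mu \in \mathbb{R}$, $\sigma > 0$, $\bar{x} \in \mathbb{R}$, let $F_0$ be the Gaussian measure $\mathcal{N}(\mu,\sigma^2)$ on $\mathbb{R}$, and set $\beta_* = (\bar{x}-\mu)/\sigma^2$. Then $$\frac{\int e^{2\beta_* x}(x-\bar{x})^2\,dF_0(x)}{\left(\int e^{\beta_* x}(x-\bar{x})^2\,dF_0(x)\right)^2} \;=\; e^{(\bar{x}-\mu)^2/\sigma^2}\,\frac{(\bar{x}-\mu)^2+\sigma^2}{\sigma^4}.$$ -/
open MeasureTheory ProbabilityTheory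
open scoped NNReal

/-- Exponential tilting of a real Gaussian measure shifts its mean. -/
lemma integral_exp_mul_smul_gaussianReal {E : Type*} [NormedAddCommGroup E] [NormedSpace ℝ E]
    [CompleteSpace E]
    (m : ℝ) (v : ℝ≥0) (t : ℝ) (f : ℝ → E) :
    ∫ x, Real.exp (t * x) • f x ∂gaussianReal m v =
      Real.exp (m * t + v * t ^ 2 / 2) • ∫ x, f x ∂gaussianReal (m + v * t) v := by
  rcases eq_or_ne v 0 with rfl | hv
  · simp [mul_comm]
  have hv' : (v : ℝ) ≠ 0 := by exact_mod_cast hv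
  rw [integral_gaussianReal_eq_integral_smul hv, integral_gaussianReal_eq_integral_smul hv,
    ← integral_smul]
  congr 1 with x
  rw [smul_smul, smul_smul, gaussianPDFReal, gaussianPDFReal, mul_assoc, ← Real.exp_add,
    mul_left_comm, ← Real.exp_add]
  congr 3
  field_simp
  ring

/-- The second moment of a real Gaussian measure about an arbitrary point. -/
lemma integral_sub_sq_gaussianReal (m : ℝ) (v : ℝ≥0) (a : ℝ) :
    ∫ x, (x - a) ^ 2 ∂gaussianReal m v = (m - a) ^ 2 + v := by
  have hmap : ∫ x, (x - a) ^ 2 ∂gaussianReal m v = ∫ x, x ^ 2 ∂gaussianReal (m - a) v := by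
    rw [← gaussianReal_map_sub_const, integral_map (by fun_prop) (by fun_prop)]
  have hvar := variance_eq_sub (memLp_id_gaussianReal (μ := m - a) (v := v) 2)
  simp only [variance_id_gaussianReal, Pi.pow_apply, id_eq, integral_id_gaussianReal] at hvar
  rw [hmap]
  linarith

/-- Explicit asymptotic variance for a Gaussian majority class: with
`F0 = N(μ, σ²)` and `β₊ = (x̄ - μ)/σ²`, the asymptotic variance
`∫ e^{2β₊x}(x - x̄)² dF0 / (∫ e^{β₊x}(x - x̄)² dF0)²` equals
`e^{(x̄-μ)²/σ²} ((x̄-μ)² + σ²)/σ⁴`. -/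
theorem asymptotic_variance_gaussian (μ xbar : ℝ) (σ : ℝ) (hσ : 0 < σ)
    (F0 : Measure ℝ) (hF0 : F0 = gaussianReal μ ⟨σ ^ 2, sq_nonneg σ⟩)
    (βs : ℝ) (hβs : βs = (xbar - μ) / σ ^ 2) :
    (∫ x, Real.exp (2 * βs * x) * (x - xbar) ^ 2 ∂F0) /
      (∫ x, Real.exp (βs * x) * (x - xbar) ^ 2 ∂F0) ^ 2 =
    Real.exp ((xbar - μ) ^ 2 / σ ^ 2) * (((xbar - μ) ^ 2 + σ ^ 2) / σ ^ 4) := by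
  have key (t : ℝ) : ∫ x, Real.exp (t * x) * (x - xbar) ^ 2 ∂F0 =
      Real.exp (μ * t + σ ^ 2 * t ^ 2 / 2) * ((μ + σ ^ 2 * t - xbar) ^ 2 + σ ^ 2) := by
    rw [hF0]
    exact (integral_exp_mul_smul_gaussianReal μ _ t fun x ↦ (x - xbar) ^ 2).trans
      (congrArg _ (integral_sub_sq_gaussianReal _ _ _))
  have hσ0 : σ ≠ 0 := hσ.ne'
  have hmean : σ ^ 2 * βs = xbar - μ := by rw [hβs]; field_simp
  have hexp : Real.exp (μ * (2 * βs) + σ ^ 2 * (2 * βs) ^ 2 / 2) =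
      Real.exp ((xbar - μ) ^ 2 / σ ^ 2) * Real.exp (μ * βs + σ ^ 2 * βs ^ 2 / 2) ^ 2 := by
    rw [← Real.exp_nat_mul, ← Real.exp_add, ← hmean]
    congr 1
    field_simp
    push_cast
    ring
  have hdouble : μ + σ ^ 2 * (2 * βs) - xbar = xbar - μ := by linarith
  have hsingle : μ + σ ^ 2 * βs - xbar = 0 := by linarith
  rw [key, key, hexp, hdouble, hsingle]
  have hpos := (Real.exp_pos (μ * βs + σ ^ 2 * βs ^ 2 / 2)).ne'
  field_simp
  ring
end

section
/- Fix $n \geq 1$ and $N \geq 1$, minority points $x_1,\dots,x_n \in \mathbb{R}^d$ with mean $\bar{x}$, and majority points $X_1,\dots,X_N \in \mathbb{R}^d$. Suppose there exists $\delta \in (0,1]$ such that for every unit vector $\omega \in \mathbb{R}^d$ at least $\delta N$ of the indices $i \in \{1,\dots,N\}$ satisfy $(X_i - \bar{x})\cdot\omega \geq 0$, and suppose $\delta N \geq 2n$. Then any critical point $(\alpha,\beta) \in \mathbb{R}\times\mathbb{R}^d$ of the centered logistic log-likelihood $\mathcal{L}_N$ (in particular, any global maximizer) satisfies $e^{\alpha}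 \leq 2n/(\delta N)$. -/
open MeasureTheory RealInnerProductSpace

/-- Centered logistic log-likelihood for minority points `x` (with mean `xbar`) and
majority points `X` in `ℝ^d`. -/
noncomputable def logLikE {d n N : ℕ} (x : Fin n → EuclideanSpace ℝ (Fin d))
    (X : Fin N → EuclideanSpace ℝ (Fin d)) (xbar : EuclideanSpace ℝ (Fin d))
    (α : ℝ) (β : EuclideanSpace ℝ (Fin d)) : ℝ :=
  (n : ℝ) * α - ∑ j, Real.log (1 + Real.exp (α + ⟪β, x j - xbar⟫))
    - ∑ i, Real.log (1 + Real.exp (α + ⟪β, X i - xbar⟫))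

theorem hasDerivAt_log_one_add_exp_add (c a : ℝ) :
    HasDerivAt (fun t => Real.log (1 + Real.exp (t + c)))
      (Real.exp (a + c) / (1 + Real.exp (a + c))) a := by
  have h : HasDerivAt (fun t => 1 + Real.exp (t + c)) (Real.exp (a + c)) a := by
    simpa using (((hasDerivAt_id a).add_const c).exp.const_add 1)
  exact h.log (by positivity)

theorem hasDerivAt_logLikE_intercept {d n N : ℕ} (x : Fin n → EuclideanSpace ℝ (Fin d))
    (X : Fin N → EuclideanSpace ℝ (Fin d)) (xbar : EuclideanSpace ℝ (Fin d))
    (α : ℝ) (β : EuclideanSpace ℝ (Fin d)) :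
    HasDerivAt (fun t => logLikE x X xbar t β)
      ((n : ℝ) - ∑ j, Real.exp (α + ⟪β, x j - xbar⟫) / (1 + Real.exp (α + ⟪β, x j - xbar⟫))
        - ∑ i, Real.exp (α + ⟪β, X i - xbar⟫) / (1 + Real.exp (α + ⟪β, X i - xbar⟫))) α := by
  have h : HasDerivAt (fun t : ℝ => (n : ℝ) * t) (n : ℝ) α := by
    simpa using (hasDerivAt_id α).const_mul (n : ℝ)
  exact (h.sub (HasDerivAt.fun_sum fun j _ => hasDerivAt_log_one_add_exp_add _ α)).sub
    (HasDerivAt.fun_sum fun i _ => hasDerivAt_log_one_add_exp_add _ α)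

/-- A lower bound on the number of points in each closed half-space with unit normal extends
to an arbitrary, possibly zero, normal vector. -/
theorem le_card_inner_nonneg {E : Type*} [NormedAddCommGroup E] [InnerProductSpace ℝ E]
    {N : ℕ} (Y : Fin N → E) {δ : ℝ} (hδ : δ ≤ 1)
    (hcount : ∀ ω : E, ‖ω‖ = 1 →
      δ * N ≤ ({i : Fin N | (0 : ℝ) ≤ ⟪Y i, ω⟫} : Set (Fin N)).ncard) (β : E) :
    δ * N ≤ (Finset.univ.filter fun i => (0 : ℝ) ≤ ⟪β, Y i⟫).card := by
  by_cases hβ : β = 0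
  · simpa [hβ] using mul_le_mul_of_nonneg_right hδ (Nat.cast_nonneg (α := ℝ) N)
  · have hpos : 0 < ‖β‖⁻¹ := inv_pos.2 (norm_pos_iff.2 hβ)
    refine (hcount (‖β‖⁻¹ • β) (norm_smul_inv_norm (𝕜 := ℝ) hβ)).trans_eq ?_
    rw [← Set.ncard_coe_finset]
    congr 2
    ext i
    simp [real_inner_smul_right, real_inner_comm, mul_nonneg_iff_of_pos_left hpos,
      -inv_pos, -norm_pos_iff]

theorem exp_div_one_add_exp_mono {a b : ℝ} (h : a ≤ b) :
    Real.exp a / (1 + Real.exp a) ≤ Real.exp b / (1 + Real.exp b) := by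
  rw [div_le_div_iff₀ (by positivity) (by positivity)]
  linarith [Real.exp_le_exp.2 h]

/-- Bound on the intercept at any critical point of the centered logistic log-likelihood:
if for every unit direction at least `δN` of the majority points lie on the nonnegative
side of the hyperplane through `xbar`, and `δN ≥ 2n`, then `e^α ≤ 2n/(δN)`. -/
theorem exp_intercept_le_of_critical {d n N : ℕ} (hn : 1 ≤ n) (hN : 1 ≤ N)
    (x : Fin n → EuclideanSpace ℝ (Fin d)) (xbar : EuclideanSpace ℝ (Fin d))
    (hmean : ((n : ℝ)⁻¹ • ∑ j, x j) = xbar)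
    (X : Fin N → EuclideanSpace ℝ (Fin d))
    (δ : ℝ) (hδ : δ ∈ Set.Ioc (0 : ℝ) 1)
    (hcount : ∀ ω : EuclideanSpace ℝ (Fin d), ‖ω‖ = 1 →
      δ * N ≤ ({i : Fin N | (0 : ℝ) ≤ ⟪X i - xbar, ω⟫} : Set (Fin N)).ncard)
    (h2n : 2 * (n : ℝ) ≤ δ * N)
    (α : ℝ) (β : EuclideanSpace ℝ (Fin d))
    (hcrit : HasFDerivAt (fun p : ℝ × EuclideanSpace ℝ (Fin d) => logLikE x X xbar p.1 p.2)
      (0 : ℝ × EuclideanSpace ℝ (Fin d) →L[ℝ] ℝ) (α, β)) :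
    Real.exp α ≤ 2 * n / (δ * N) := by
  have hderiv : (n : ℝ)
      - ∑ j, Real.exp (α + ⟪β, x j - xbar⟫) / (1 + Real.exp (α + ⟪β, x j - xbar⟫))
      - ∑ i, Real.exp (α + ⟪β, X i - xbar⟫) / (1 + Real.exp (α + ⟪β, X i - xbar⟫)) = 0 := by
    have h : HasDerivAt (fun t => logLikE x X xbar t β) 0 α := by
      simpa [Function.comp_def] using
        hcrit.comp_hasDerivAt α ((hasDerivAt_id α).prodMk (hasDerivAt_const α β))
    exact (hasDerivAt_logLikE_intercept x X xbar α β).unique h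
  have hminority : 0 ≤ ∑ j, Real.exp (α + ⟪β, x j - xbar⟫) /
      (1 + Real.exp (α + ⟪β, x j - xbar⟫)) := by positivity
  have hcard := le_card_inner_nonneg (fun i => X i - xbar) hδ.2 hcount β
  have hmajority : δ * N * (Real.exp α / (1 + Real.exp α)) ≤
      ∑ i, Real.exp (α + ⟪β, X i - xbar⟫) / (1 + Real.exp (α + ⟪β, X i - xbar⟫)) := by
    calc δ * N * (Real.exp α / (1 + Real.exp α))
        ≤ (Finset.univ.filter fun i => (0 : ℝ) ≤ ⟪β, X i - xbar⟫).card *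
            (Real.exp α / (1 + Real.exp α)) :=
          mul_le_mul_of_nonneg_right hcard (by positivity)
      _ = ∑ _i ∈ Finset.univ.filter fun i => (0 : ℝ) ≤ ⟪β, X i - xbar⟫,
            Real.exp α / (1 + Real.exp α) := by simp
      _ ≤ ∑ i ∈ Finset.univ.filter fun i => (0 : ℝ) ≤ ⟪β, X i - xbar⟫,
            Real.exp (α + ⟪β, X i - xbar⟫) / (1 + Real.exp (α + ⟪β, X i - xbar⟫)) :=
          Finset.sum_le_sum fun i hi =>
            exp_div_one_add_exp_mono (le_add_of_nonneg_right (Finset.mem_filter.1 hi).2)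
      _ ≤ _ := Finset.sum_le_sum_of_subset_of_nonneg (Finset.filter_subset _ _)
          fun i _ _ => by positivity
  have hbound : δ * N * (Real.exp α / (1 + Real.exp α)) ≤ n := by linarith
  rw [← mul_div_assoc, div_le_iff₀ (by positivity)] at hbound
  have hNpos : (0 : ℝ) < N := by exact_mod_cast hN
  rw [le_div_iff₀ (mul_pos hδ.1 hNpos)]
  linarith [mul_le_mul_of_nonneg_right h2n (Real.exp_pos α).le]
end
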